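/- arXiv:2108.02157 — 2 statements merged into one kernel-verified Lean document; each statement's English description precedes it below -/
import Mathlib

section
/- Let $\mathbb{K}$ be a field of characteristic zero and let $K \in \mathbb{K}[x_0,\dots,x_n]$ be a homogeneous polynomial of degree $m \geq 0$ such that all first partial derivatives of $K$ are equal, i.e. $\partial_{x_i} K = \partial_{x_j} K$ for all $0 \leq i,j \leq n$. Then $K = \alpha H^m$ for some scalar $\alpha \in \mathbb{K}$, where $H = \sum_{i=0}^n x_i$. -/
open MvPolynomial

theorem MvPolynomial.pderiv_pderiv_comm {σ R : Type*} [CommRing R] (i j : σ)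
    (p : MvPolynomial σ R) : pderiv i (pderiv j p) = pderiv j (pderiv i p) := by
  classical
  have h : ⁅(pderiv i : Derivation R (MvPolynomial σ R) (MvPolynomial σ R)),
      (pderiv j : Derivation R (MvPolynomial σ R) (MvPolynomial σ R))⁆ = 0 := by
    apply MvPolynomial.derivation_ext
    intro k
    simp [Derivation.commutator_apply, pderiv_X, Pi.single_apply, apply_ite]
  simpa [Derivation.commutator_apply, sub_eq_zero] using congrArg (fun D => D p) h

/-- In characteristic zero, a homogeneous polynomial `K` of degree `m` all of
whose first partial derivatives coincide is a scalar multiple of `H^m`, `H = x₀ + ⋯ + xₙ`. -/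
theorem stmt8 {𝕂 : Type*} [Field 𝕂] [CharZero 𝕂] (n m : ℕ)
    (K : MvPolynomial (Fin (n + 1)) 𝕂) (hK : K.IsHomogeneous m)
    (hder : ∀ i j : Fin (n + 1), pderiv i K = pderiv j K) :
    ∃ α : 𝕂, K = C α * (∑ i : Fin (n + 1), (X i : MvPolynomial (Fin (n + 1)) 𝕂)) ^ m := by
  induction m generalizing K with
  | zero =>
    exact ⟨K.coeff 0, by
      rw [pow_zero, mul_one]
      exact totalDegree_eq_zero_iff_eq_C.mp (Nat.le_zero.mp hK.totalDegree_le)⟩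
  | succ m ih =>
    obtain ⟨a, ha⟩ := ih (pderiv 0 K) (by simpa using hK.pderiv (i := 0)) fun i j => by
      rw [pderiv_pderiv_comm, pderiv_pderiv_comm j, hder i j]
    have euler := hK.sum_X_mul_pderiv
    simp_rw [fun i => hder i 0, ← Finset.sum_mul, ha] at euler
    have hm : ((m + 1 : ℕ) : 𝕂) ≠ 0 := Nat.cast_ne_zero.mpr m.succ_ne_zero
    refine ⟨((m + 1 : ℕ) : 𝕂)⁻¹ * a, ?_⟩
    rw [C_mul, mul_assoc, pow_succ', mul_left_comm (C a), euler, nsmul_eq_mul, ← mul_assoc,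
      ← map_natCast (C : 𝕂 →+* MvPolynomial (Fin (n + 1)) 𝕂), ← C_mul, inv_mul_cancel₀ hm,
      C_1, one_mul]
end

section
/- Let $\mathbb{K}$ be a field of characteristic zero and $R = \mathbb{K}[x_0,\dots,x_n]/(x_0^{a_0},\dots,x_n^{a_n})$ with all $a_i \geq 1$. Then $R$ has the Strong Lefschetz Property: there exists a linear form $L \in R^1$ such that for all integers $k \geq 0$ and $e \geq 1$, the multiplication map $\cdot L^e \colon R^k \to R^{k+e}$ has maximal rank (i.e. is injective or surjective). -/
open MvPolynomial Module

/-- The degree-`k` graded piece of the quotient of the polynomial ring by a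
(homogeneous) ideal `I`: the image of the homogeneous polynomials of degree `k`. -/
noncomputable def gradedPiece {𝕂 : Type*} [Field 𝕂] {n : ℕ}
    (I : Ideal (MvPolynomial (Fin n) 𝕂)) (k : ℕ) :
    Submodule 𝕂 (MvPolynomial (Fin n) 𝕂 ⧸ I) :=
  (MvPolynomial.homogeneousSubmodule (Fin n) 𝕂 k).map (Ideal.Quotient.mkₐ 𝕂 I).toLinearMap

/-- Operators `E` and `F` on a graded vector space, of degree `1` and `-1`, whose commutator
acts on degree `d` as the scalar `2 * d - s`, with the grading supported in degrees `0, …, s`. -/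
structure IsLefschetzPair {𝕂 M : Type*} [Field 𝕂] [AddCommGroup M] [Module 𝕂 M]
    (E F : Module.End 𝕂 M) (V : ℤ → Submodule 𝕂 M) (s : ℤ) : Prop where
  raise : ∀ d, ∀ v ∈ V d, E v ∈ V (d + 1)
  lower : ∀ d, ∀ v ∈ V d, F v ∈ V (d - 1)
  comm : ∀ d, ∀ v ∈ V d, E (F v) - F (E v) = ((2 * d - s : ℤ) : 𝕂) • v
  eq_bot_of_neg : ∀ d < 0, V d = ⊥
  eq_bot_of_gt : ∀ d, s < d → V d = ⊥

namespace IsLefschetzPair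

variable {𝕂 M : Type*} [Field 𝕂] [AddCommGroup M] [Module 𝕂 M]
  {E F : Module.End 𝕂 M} {V : ℤ → Submodule 𝕂 M} {s : ℤ}

theorem symm (h : IsLefschetzPair E F V s) : IsLefschetzPair F E (fun d => V (s - d)) s where
  raise d v hv := by
    have := h.lower _ v hv
    rwa [show s - d - 1 = s - (d + 1) by ring] at this
  lower d v hv := by
    have := h.raise _ v hv
    rwa [show s - d + 1 = s - (d - 1) by ring] at this
  comm d v hv := by
    rw [← neg_sub, h.comm _ v hv, ← neg_smul]
    congr 1
    push_cast
    ring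
  eq_bot_of_neg d hd := h.eq_bot_of_gt _ (by omega)
  eq_bot_of_gt d hd := h.eq_bot_of_neg _ (by omega)

theorem pow_raise (h : IsLefschetzPair E F V s) (r : ℕ) {d : ℤ} {v : M} (hv : v ∈ V d) :
    (E ^ r) v ∈ V (d + r) := by
  induction r with
  | zero => simpa using hv
  | succ r ih =>
    rw [pow_succ', Module.End.mul_apply]
    have := h.raise _ _ ih
    rwa [add_assoc, ← Nat.cast_succ] at this

theorem lower_pow_succ (h : IsLefschetzPair E F V s) (r : ℕ) {d : ℤ} {v : M} (hv : v ∈ V d) :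
    F ((E ^ (r + 1)) v) =
      (E ^ (r + 1)) (F v) + (((r + 1) * (s - 2 * d - r) : ℤ) : 𝕂) • (E ^ r) v := by
  induction r with
  | zero =>
    have := h.comm d v hv
    rw [sub_eq_iff_eq_add] at this
    simp only [zero_add, pow_one, pow_zero, Module.End.one_apply, this]
    rw [add_right_comm, ← add_smul]
    push_cast
    ring_nf
    simp
  | succ r ih =>
    have := h.comm _ _ (h.pow_raise (r + 1) hv)
    rw [sub_eq_iff_eq_add, ← sub_eq_iff_eq_add'] at this
    rw [pow_succ' E (r + 1), Module.End.mul_apply, ← this, ih, map_add, map_smul,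
      Module.End.mul_apply, ← Module.End.mul_apply E (E ^ r), ← pow_succ', add_sub_assoc,
      ← sub_smul]
    congr 2
    push_cast
    ring

theorem map_pow_le (h : IsLefschetzPair E F V s) (m : ℕ) (d : ℤ) :
    (V d).map (E ^ m) ≤ V (d + m) :=
  Submodule.map_le_iff_le_comap.2 fun _ hv => h.pow_raise m hv

variable [CharZero 𝕂]

theorem eq_zero_of_pow_eq_zero_of_lower_eq_zero (h : IsLefschetzPair E F V s) {d : ℤ} {v : M}
    (hv : v ∈ V d) (hF : F v = 0) (r : ℕ) (hr : r ≤ s - 2 * d) (hE : (E ^ r) v = 0) : v = 0 := by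
  induction r with
  | zero => simpa using hE
  | succ r ih =>
    refine ih (by push_cast at hr; omega) ?_
    have := h.lower_pow_succ r hv
    rw [hE, hF, map_zero, map_zero, zero_add, eq_comm, smul_eq_zero] at this
    refine this.resolve_left ?_
    rw [Int.cast_eq_zero]
    push_cast at hr
    exact mul_ne_zero (by omega) (by omega)

theorem eq_zero_of_pow_eq_zero (h : IsLefschetzPair E F V s) (k m : ℕ) (hm : (m : ℤ) = s - 2 * k)
    {v : M} (hv : v ∈ V k) (hE : (E ^ m) v = 0) : v = 0 := by
  induction k generalizing m v with
  | zero =>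
    refine h.eq_zero_of_pow_eq_zero_of_lower_eq_zero hv ?_ m hm.le hE
    have := h.lower _ v hv
    rwa [h.eq_bot_of_neg _ (by simp), Submodule.mem_bot] at this
  | succ k ih =>
    refine h.eq_zero_of_pow_eq_zero_of_lower_eq_zero hv ?_ m hm.le hE
    refine ih (m + 2) (by push_cast at hm ⊢; omega) ?_ ?_
    · simpa using h.lower _ v hv
    · have := h.lower_pow_succ m hv
      rw [hm, sub_self, mul_zero, Int.cast_zero, zero_smul, add_zero, pow_succ',
        Module.End.mul_apply, hE, map_zero, map_zero] at this
      rw [pow_succ', Module.End.mul_apply, pow_succ', ← this, map_zero]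

theorem injOn_pow (h : IsLefschetzPair E F V s) (k m : ℕ) (hm : (m : ℤ) ≤ s - 2 * k) :
    Set.InjOn (E ^ m) (V k) := by
  obtain ⟨t, ht⟩ := Int.eq_ofNat_of_zero_le (sub_nonneg.2 hm)
  intro v hv w hw hvw
  rw [← sub_eq_zero]
  refine h.eq_zero_of_pow_eq_zero k (t + m) (by push_cast; omega) (sub_mem hv hw) ?_
  rw [pow_add, Module.End.mul_apply, map_sub, hvw, sub_self, map_zero]

theorem finrank_map_pow_of_le (h : IsLefschetzPair E F V s) (k m : ℕ)
    (hm : (m : ℤ) ≤ s - 2 * k) : finrank 𝕂 ((V k).map (E ^ m)) = finrank 𝕂 (V k) := by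
  rw [← LinearMap.range_domRestrict]
  exact LinearMap.finrank_range_of_inj (Set.injOn_iff_injective.1 (h.injOn_pow k m hm))

variable [∀ d, FiniteDimensional 𝕂 (V d)]

theorem finrank_le_finrank_add (h : IsLefschetzPair E F V s) (k m : ℕ)
    (hm : (m : ℤ) ≤ s - 2 * k) : finrank 𝕂 (V k) ≤ finrank 𝕂 (V (k + m)) :=
  (h.finrank_map_pow_of_le k m hm).symm.le.trans (Submodule.finrank_mono (h.map_pow_le m k))

theorem map_pow_eq_of_eq (h : IsLefschetzPair E F V s) (k m : ℕ) (hm : (m : ℤ) = s - 2 * k) :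
    (V k).map (E ^ m) = V (k + m) := by
  refine Submodule.eq_of_le_of_finrank_le (h.map_pow_le m k) ?_
  rw [h.finrank_map_pow_of_le k m hm.le]
  have := h.symm.finrank_le_finrank_add k m hm.le
  rwa [show s - (k : ℤ) = k + m by omega, show s - ((k : ℤ) + m) = k by omega] at this

theorem map_pow_eq_of_ge (h : IsLefschetzPair E F V s) (k m : ℕ) (hm : s - 2 * k ≤ m) :
    (V k).map (E ^ m) = V (k + m) := by
  refine le_antisymm (h.map_pow_le m k) ?_
  rcases lt_or_ge s (k + m) with hs | hs
  · rw [h.eq_bot_of_gt _ hs]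
    exact bot_le
  obtain ⟨j, hj⟩ := Int.eq_ofNat_of_zero_le (sub_nonneg.2 hs)
  obtain ⟨t, ht⟩ := Int.eq_ofNat_of_zero_le (show (0 : ℤ) ≤ k - j by omega)
  have := h.map_pow_eq_of_eq j (m + t) (by push_cast; omega)
  rw [show (j : ℤ) + (m + t : ℕ) = k + m by push_cast; omega, pow_add, Module.End.mul_eq_comp,
    Submodule.map_comp] at this
  rw [← this]
  refine Submodule.map_mono ((h.map_pow_le t j).trans_eq ?_)
  congr 1
  omega

/-- Powers of `E` have maximal rank between graded pieces. -/
theorem finrank_map_pow (h : IsLefschetzPair E F V s) (k m : ℕ) :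
    finrank 𝕂 ((V k).map (E ^ m)) = min (finrank 𝕂 (V k)) (finrank 𝕂 (V (k + m))) := by
  rcases le_total (m : ℤ) (s - 2 * k) with hm | hm
  · rw [h.finrank_map_pow_of_le k m hm, min_eq_left (h.finrank_le_finrank_add k m hm)]
  · have := h.map_pow_eq_of_ge k m hm
    rw [min_eq_right, this]
    rw [← this]
    exact Submodule.finrank_map_le _ _

end IsLefschetzPair

section MonomialCompleteIntersection

variable {𝕂 : Type*} [Field 𝕂] {N : ℕ}

/-- The grading of `gradedPiece`, extended by zero to negative degrees. -/
noncomputable def intGradedPiece (I : Ideal (MvPolynomial (Fin N) 𝕂)) :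
    ℤ → Submodule 𝕂 (MvPolynomial (Fin N) 𝕂 ⧸ I)
  | Int.ofNat k => gradedPiece I k
  | Int.negSucc _ => ⊥

theorem mem_gradedPiece {I : Ideal (MvPolynomial (Fin N) 𝕂)} {k : ℕ}
    {v : MvPolynomial (Fin N) 𝕂 ⧸ I} :
    v ∈ gradedPiece I k ↔ ∃ p, p.IsHomogeneous k ∧ Ideal.Quotient.mk I p = v :=
  Iff.rfl

instance finiteDimensional_gradedPiece (I : Ideal (MvPolynomial (Fin N) 𝕂)) (k : ℕ) :
    FiniteDimensional 𝕂 (gradedPiece I k) :=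
  Module.Finite.iff_fg.2 ((homogeneousSubmodule_fg (Fin N) 𝕂 k).map _)

instance finiteDimensional_intGradedPiece (I : Ideal (MvPolynomial (Fin N) 𝕂)) (d : ℤ) :
    FiniteDimensional 𝕂 (intGradedPiece I d) := by
  cases d
  · exact finiteDimensional_gradedPiece I _
  · exact inferInstanceAs (FiniteDimensional 𝕂 (⊥ : Submodule 𝕂 (MvPolynomial (Fin N) 𝕂 ⧸ I)))

/-- The lowering operator `∑ i, b i • ∂ᵢ - Xᵢ * ∂ᵢ²` on polynomials. -/
noncomputable def lowering (b : Fin N → ℕ) :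
    MvPolynomial (Fin N) 𝕂 →ₗ[𝕂] MvPolynomial (Fin N) 𝕂 :=
  ∑ i, (b i • (pderiv i : Derivation 𝕂 _ (MvPolynomial (Fin N) 𝕂)).toLinearMap -
    LinearMap.mulLeft 𝕂 (X i) ∘ₗ
      (pderiv i : Derivation 𝕂 _ (MvPolynomial (Fin N) 𝕂)).toLinearMap ∘ₗ
      (pderiv i : Derivation 𝕂 _ (MvPolynomial (Fin N) 𝕂)).toLinearMap)

theorem lowering_apply (b : Fin N → ℕ) (p : MvPolynomial (Fin N) 𝕂) :
    lowering b p = ∑ i, ((b i : MvPolynomial (Fin N) 𝕂) * pderiv i p -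
      X i * pderiv i (pderiv i p)) := by
  simp [lowering]

theorem isHomogeneous_X_mul_pderiv {p : MvPolynomial (Fin N) 𝕂} {k : ℕ} (hp : p.IsHomogeneous k)
    (i : Fin N) : (X i * pderiv i p).IsHomogeneous k := by
  cases k with
  | zero =>
    rw [← totalDegree_zero_iff_isHomogeneous, totalDegree_eq_zero_iff_eq_C] at hp
    rw [hp, pderiv_C, mul_zero]
    exact isHomogeneous_zero _ _ _
  | succ k =>
    rw [add_comm]
    exact (isHomogeneous_X 𝕂 i).mul hp.pderiv

theorem isHomogeneous_lowering (b : Fin N → ℕ) {p : MvPolynomial (Fin N) 𝕂} {k : ℕ}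
    (hp : p.IsHomogeneous k) : (lowering b p).IsHomogeneous (k - 1) := by
  rw [lowering_apply]
  refine IsHomogeneous.sum _ _ _ fun i _ => IsHomogeneous.sub ?_ ?_
  · rw [← map_natCast (C : 𝕂 →+* _)]
    exact hp.pderiv.C_mul _
  · exact isHomogeneous_X_mul_pderiv hp.pderiv i

theorem lowering_eq_zero (b : Fin N → ℕ) {p : MvPolynomial (Fin N) 𝕂}
    (hp : p.IsHomogeneous 0) : lowering b p = 0 := by
  rw [← totalDegree_zero_iff_isHomogeneous, totalDegree_eq_zero_iff_eq_C] at hp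
  rw [hp, lowering_apply]
  simp

theorem pderiv_sum_X (i : Fin N) : pderiv i (∑ j, X j : MvPolynomial (Fin N) 𝕂) = 1 := by
  classical
  simp [map_sum, pderiv_X, Pi.single_apply]

theorem sum_X_mul_lowering_sub (b : Fin N → ℕ) {p : MvPolynomial (Fin N) 𝕂} {k : ℕ}
    (hp : p.IsHomogeneous k) :
    (∑ j, X j) * lowering b p - lowering b ((∑ j, X j) * p) =
      ((2 * k - (∑ i, b i : ℕ) : ℤ) : 𝕂) • p := by
  have euler := hp.sum_X_mul_pderiv
  have key : ∀ i, pderiv i ((∑ j, X j) * p) = (∑ j, X j) * pderiv i p + p := fun i => by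
    rw [pderiv_mul, pderiv_sum_X]
    ring
  have key' : ∀ i, pderiv i (pderiv i ((∑ j, X j) * p)) =
      (∑ j, X j) * pderiv i (pderiv i p) + 2 * pderiv i p := fun i => by
    rw [key, map_add, pderiv_mul, pderiv_sum_X]
    ring
  simp only [lowering_apply, key']
  simp only [key]
  rw [Finset.mul_sum, ← Finset.sum_sub_distrib]
  calc _ = ∑ i, (2 * (X i * pderiv i p) - (b i : MvPolynomial (Fin N) 𝕂) * p) :=
        Finset.sum_congr rfl fun i _ => by ring
    _ = _ := by
        rw [Finset.sum_sub_distrib, ← Finset.mul_sum, euler, ← Finset.sum_mul, smul_eq_C_mul]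
        simp only [nsmul_eq_mul, Int.cast_sub, Int.cast_mul, Int.cast_natCast, Int.cast_ofNat,
          map_sub, map_mul, map_natCast, map_ofNat]
        rw [Nat.cast_sum]
        ring

/-- The ideal generated by the powers `Xᵢ ^ aᵢ`. -/
noncomputable abbrev powIdeal (𝕂 : Type*) [Field 𝕂] (a : Fin N → ℕ) :
    Ideal (MvPolynomial (Fin N) 𝕂) :=
  Ideal.span (Set.range fun i : Fin N => (X i : MvPolynomial (Fin N) 𝕂) ^ a i)

theorem X_pow_mul_mem_powIdeal (a : Fin N → ℕ) (i : Fin N) (p : MvPolynomial (Fin N) 𝕂) :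
    X i ^ a i * p ∈ powIdeal 𝕂 a :=
  Ideal.mul_mem_right _ _ (Ideal.subset_span ⟨i, rfl⟩)

theorem lowering_X_pow_mul_mem (b : Fin N → ℕ) (j : Fin N) (p : MvPolynomial (Fin N) 𝕂) :
    lowering b (X j ^ (b j + 1) * p) ∈ powIdeal 𝕂 (fun i => b i + 1) := by
  rw [lowering_apply]
  refine sum_mem fun i _ => ?_
  have hmem := X_pow_mul_mem_powIdeal (𝕂 := 𝕂) (fun i => b i + 1) j
  rcases eq_or_ne j i with rfl | hij
  · have h1 : pderiv j (X j ^ (b j + 1) * p) =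
        ((b j : MvPolynomial (Fin N) 𝕂) + 1) * (X j ^ b j * p) +
          X j ^ (b j + 1) * pderiv j p := by
      rw [pderiv_mul, pderiv_pow, pderiv_X_self]
      push_cast
      ring
    have h2 : X j * pderiv j (X j ^ b j) =
        (b j : MvPolynomial (Fin N) 𝕂) * X j ^ b j := by
      rw [pderiv_pow, pderiv_X_self]
      rcases hb : b j with _ | c
      · simp
      · simp only [Nat.add_sub_cancel]
        ring
    have h3 : pderiv j ((b j : MvPolynomial (Fin N) 𝕂) + 1) = 0 := by
      rw [map_add, Derivation.map_natCast, pderiv_one, add_zero]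
    have h4 : pderiv j (X j ^ (b j + 1) : MvPolynomial (Fin N) 𝕂) =
        ((b j : MvPolynomial (Fin N) 𝕂) + 1) * X j ^ b j := by
      rw [pderiv_pow, pderiv_X_self]
      push_cast
      simp
    have h5 : pderiv j (pderiv j (X j ^ (b j + 1) * p)) =
        ((b j : MvPolynomial (Fin N) 𝕂) + 1) *
          (pderiv j (X j ^ b j) * p + 2 * (X j ^ b j * pderiv j p)) +
          X j ^ (b j + 1) * pderiv j (pderiv j p) := by
      rw [h1, map_add, pderiv_mul, h3, pderiv_mul, pderiv_mul, h4]
      ring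
    have : (b j : MvPolynomial (Fin N) 𝕂) * pderiv j (X j ^ (b j + 1) * p) -
          X j * pderiv j (pderiv j (X j ^ (b j + 1) * p)) =
        X j ^ (b j + 1) *
          ((b j : MvPolynomial (Fin N) 𝕂) * pderiv j p -
            2 * ((b j : MvPolynomial (Fin N) 𝕂) + 1) * pderiv j p -
            X j * pderiv j (pderiv j p)) := by
      rw [h5, h1]
      linear_combination (-((b j : MvPolynomial (Fin N) 𝕂) + 1) * p) * h2
    rw [this]
    exact hmem _
  · have h1 : ∀ q : MvPolynomial (Fin N) 𝕂,
        pderiv i (X j ^ (b j + 1) * q) = X j ^ (b j + 1) * pderiv i q := fun q => by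
      rw [pderiv_mul, pderiv_pow, pderiv_X_of_ne hij]
      ring
    rw [h1, h1, mul_left_comm, mul_left_comm (X i), ← mul_sub]
    exact hmem _

theorem lowering_mem (b : Fin N → ℕ) {p : MvPolynomial (Fin N) 𝕂}
    (hp : p ∈ powIdeal 𝕂 (fun i => b i + 1)) :
    lowering b p ∈ powIdeal 𝕂 (fun i => b i + 1) := by
  obtain ⟨c, rfl⟩ := (Ideal.mem_span_range_iff_exists_fun).1 hp
  rw [map_sum]
  refine sum_mem fun i _ => ?_
  rw [mul_comm]
  exact lowering_X_pow_mul_mem b i _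

/-- The lowering operator on the quotient by the ideal generated by the `Xᵢ ^ (bᵢ + 1)`. -/
noncomputable def quotientLowering (𝕂 : Type*) [Field 𝕂] (b : Fin N → ℕ) :
    Module.End 𝕂 (MvPolynomial (Fin N) 𝕂 ⧸ powIdeal 𝕂 (fun i => b i + 1)) :=
  Submodule.mapQ ((powIdeal 𝕂 (fun i => b i + 1)).restrictScalars 𝕂)
    ((powIdeal 𝕂 (fun i => b i + 1)).restrictScalars 𝕂) (lowering b)
    fun _ hp => lowering_mem b hp

theorem quotientLowering_mk (b : Fin N → ℕ) (p : MvPolynomial (Fin N) 𝕂) :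
    quotientLowering 𝕂 b (Ideal.Quotient.mk _ p) = Ideal.Quotient.mk _ (lowering b p) :=
  rfl

theorem mem_powIdeal_of_sum_lt (b : Fin N → ℕ) {p : MvPolynomial (Fin N) 𝕂} {k : ℕ}
    (hp : p.IsHomogeneous k) (hk : ∑ i, b i < k) : p ∈ powIdeal 𝕂 (fun i => b i + 1) := by
  rw [p.as_sum]
  refine sum_mem fun d hd => ?_
  have hdeg : ∑ i, d i = k := by
    rw [hp.degree_eq_sum_deg_support hd, ← Finsupp.degree_apply, Finsupp.degree_eq_sum]
  obtain ⟨i, -, hi⟩ := Finset.exists_lt_of_sum_lt (hk.trans_eq hdeg.symm)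
  have : (X i : MvPolynomial (Fin N) 𝕂) ^ (b i + 1) ∣ monomial d (coeff d p) := by
    rw [X_pow_eq_monomial, monomial_dvd_monomial]
    exact ⟨Or.inr (Finsupp.single_le_iff.2 hi), one_dvd _⟩
  exact Ideal.mem_of_dvd _ this (Ideal.subset_span ⟨i, rfl⟩)

theorem isLefschetzPair_quotient (b : Fin N → ℕ) :
    IsLefschetzPair
      (LinearMap.mulLeft 𝕂 (Ideal.Quotient.mk (powIdeal 𝕂 (fun i => b i + 1)) (∑ i, X i)))
      (quotientLowering 𝕂 b) (intGradedPiece (powIdeal 𝕂 (fun i => b i + 1)))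
      ((∑ i, b i : ℕ) : ℤ) where
  raise d v hv := by
    rcases d with k | k
    · obtain ⟨p, hp, rfl⟩ := mem_gradedPiece.1 hv
      refine mem_gradedPiece.2 ⟨(∑ i, X i) * p, ?_, map_mul _ _ _⟩
      rw [add_comm]
      exact (IsHomogeneous.sum _ _ _ fun i _ => isHomogeneous_X 𝕂 i).mul hp
    · rw [(Submodule.mem_bot 𝕂).1 hv, map_zero]
      exact zero_mem _
  lower d v hv := by
    rcases d with k | k
    · obtain ⟨p, hp, rfl⟩ := mem_gradedPiece.1 hv
      rw [quotientLowering_mk]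
      cases k with
      | zero =>
        rw [lowering_eq_zero b hp, map_zero]
        exact zero_mem _
      | succ k =>
        rw [show Int.ofNat (k + 1) - 1 = Int.ofNat k by simp]
        exact mem_gradedPiece.2 ⟨_, isHomogeneous_lowering b hp, rfl⟩
    · rw [(Submodule.mem_bot 𝕂).1 hv, map_zero]
      exact zero_mem _
  comm d v hv := by
    rcases d with k | k
    · obtain ⟨p, hp, rfl⟩ := mem_gradedPiece.1 hv
      rw [LinearMap.mulLeft_apply, LinearMap.mulLeft_apply, quotientLowering_mk, ← map_mul,
        ← map_mul, quotientLowering_mk, ← map_sub, sum_X_mul_lowering_sub b hp]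
      rfl
    · rw [(Submodule.mem_bot 𝕂).1 hv]
      simp
  eq_bot_of_neg d hd := by
    rcases d with k | k
    · exact absurd hd (by simp)
    · rfl
  eq_bot_of_gt d hd := by
    rcases d with k | k
    · rw [eq_bot_iff]
      rintro v hv
      obtain ⟨p, hp, rfl⟩ := mem_gradedPiece.1 hv
      exact (Submodule.mem_bot 𝕂).2
        (Ideal.Quotient.eq_zero_iff_mem.2 (mem_powIdeal_of_sum_lt b hp (Int.ofNat_lt.1 hd)))
    · rfl

end MonomialCompleteIntersection

/-- In characteristic zero, `R = 𝕂[x₀,…,xₙ]/(x₀^{a₀},…,xₙ^{aₙ})` (all `aᵢ ≥ 1`)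
has the Strong Lefschetz Property: there is a linear form `L ∈ R¹` such that multiplication
`·L^e : R^k → R^(k+e)` has maximal rank for all `k ≥ 0`, `e ≥ 1`. -/
theorem stmt14 {𝕂 : Type*} [Field 𝕂] [CharZero 𝕂] (n : ℕ) (a : Fin (n + 1) → ℕ)
    (ha : ∀ i, 1 ≤ a i) :
    ∃ L : MvPolynomial (Fin (n + 1)) 𝕂, L.IsHomogeneous 1 ∧
      ∀ k e : ℕ, 1 ≤ e →
        finrank 𝕂
            (Submodule.map
              (LinearMap.mulLeft 𝕂
                (Ideal.Quotient.mk
                  (Ideal.span (Set.range fun i : Fin (n + 1) =>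
                    (X i : MvPolynomial (Fin (n + 1)) 𝕂) ^ a i)) (L ^ e)))
              (gradedPiece (Ideal.span (Set.range fun i : Fin (n + 1) =>
                    (X i : MvPolynomial (Fin (n + 1)) 𝕂) ^ a i)) k))
          = min
              (finrank 𝕂 (gradedPiece (Ideal.span (Set.range fun i : Fin (n + 1) =>
                    (X i : MvPolynomial (Fin (n + 1)) 𝕂) ^ a i)) k))
              (finrank 𝕂 (gradedPiece (Ideal.span (Set.range fun i : Fin (n + 1) =>
                    (X i : MvPolynomial (Fin (n + 1)) 𝕂) ^ a i)) (k + e))) := by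
  obtain ⟨b, rfl⟩ : ∃ b : Fin (n + 1) → ℕ, a = fun i => b i + 1 :=
    ⟨fun i => a i - 1, funext fun i => (Nat.sub_add_cancel (ha i)).symm⟩
  refine ⟨∑ i, X i, IsHomogeneous.sum _ _ _ fun i _ => isHomogeneous_X 𝕂 i, fun k e _ => ?_⟩
  have := (isLefschetzPair_quotient (𝕂 := 𝕂) b).finrank_map_pow k e
  rw [LinearMap.pow_mulLeft, ← map_pow] at this
  exact this
end
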